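/- arXiv:2111.14234 — 3 statements merged into one kernel-verified Lean document; each statement's English description precedes it below -/
import Mathlib

section
/- Let n ≥ 4 be an integer and define the iteration k_0 = π(n), k_{j+1} = π(n − k_j) for j ≥ 0. Then there exist integers k' ≤ k'' and an index J such that k_{2j+1} = k' and k_{2j} = k'' for all j ≥ J; moreover π(n − k'') = k' and π(n − k') = k''. -/
/-- The iteration `k₀ = π(n)`, `k_{j+1} = π(n - k_j)`. -/
noncomputable def kseq (n : ℕ) : ℕ → ℕ
  | 0 => Nat.primeCounting n
  | j + 1 => Nat.primeCounting (n - kseq n j)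

theorem antitone_primeCounting_sub (n : ℕ) : Antitone fun k => Nat.primeCounting (n - k) :=
  fun _ _ h => Nat.monotone_primeCounting (Nat.sub_le_sub_left h n)

theorem kseq_succ (n j : ℕ) : kseq n (j + 1) = Nat.primeCounting (n - kseq n j) := rfl

theorem antitone_kseq_even (n : ℕ) : Antitone fun j => kseq n (2 * j) := by
  refine antitone_nat_of_succ_le fun j => ?_
  induction j with
  | zero => exact antitone_primeCounting_sub n (Nat.zero_le (kseq n 1))
  | succ j ih => exact antitone_primeCounting_sub n (antitone_primeCounting_sub n ih)

theorem kseq_odd_le_even (n j : ℕ) : kseq n (2 * j + 1) ≤ kseq n (2 * j) := by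
  induction j with
  | zero => exact antitone_primeCounting_sub n (Nat.zero_le (kseq n 0))
  | succ j ih => exact antitone_primeCounting_sub n (antitone_primeCounting_sub n ih)

theorem exists_forall_ge_eq_of_antitone {f : ℕ → ℕ} (hf : Antitone f) :
    ∃ J, ∀ j, J ≤ j → f j = f J := by
  obtain ⟨J, hJ⟩ := exists_minimal_of_wellFoundedLT (fun m => m ∈ Set.range f) ⟨f 0, 0, rfl⟩
  obtain ⟨⟨J, rfl⟩, hmin⟩ := hJ
  exact ⟨J, fun j hj => (hf hj).antisymm (hmin ⟨j, rfl⟩ (hf hj))⟩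

theorem stmt_2 (n : ℕ) (hn : 4 ≤ n) :
    ∃ k' k'' J : ℕ, k' ≤ k'' ∧
      (∀ j, J ≤ j → kseq n (2 * j + 1) = k' ∧ kseq n (2 * j) = k'') ∧
      Nat.primeCounting (n - k'') = k' ∧ Nat.primeCounting (n - k') = k'' := by
  obtain ⟨J, hJ⟩ := exists_forall_ge_eq_of_antitone (antitone_kseq_even n)
  refine ⟨kseq n (2 * J + 1), kseq n (2 * J), J, kseq_odd_le_even n J, fun j hj => ?_, rfl,
    hJ (J + 1) J.le_succ⟩
  have h : kseq n (2 * j) = kseq n (2 * J) := hJ j hj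
  exact ⟨by rw [kseq_succ, kseq_succ, h], h⟩
end

section
/- Let n ≥ 4 be an integer and let k', k'' be integers with 1 ≤ k' < k'' such that π(n − k'') = k' and π(n − k') = k''. Then k'' = k' + 1, the number n − k' is prime, and one has π(n − k') = k' + 1 and π(n − k' − 1) = k'. -/
theorem Nat.primeCounting_succ_eq (m : ℕ) :
    Nat.primeCounting (m + 1) =
      Nat.primeCounting m + if Nat.Prime (m + 1) then 1 else 0 :=
  Nat.count_succ Nat.Prime (m + 1)

theorem Nat.primeCounting_add_le_add (m d : ℕ) :
    Nat.primeCounting (m + d) ≤ Nat.primeCounting m + d := by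
  induction d with
  | zero => simp
  | succ d ih =>
    rw [← Nat.add_assoc, Nat.primeCounting_succ_eq]
    split_ifs <;> omega

theorem Nat.primeCounting_add_two_le {m : ℕ} (hm : 2 ≤ m) :
    Nat.primeCounting (m + 2) ≤ Nat.primeCounting m + 1 := by
  rw [Nat.primeCounting_succ_eq (m + 1), Nat.primeCounting_succ_eq m]
  split_ifs with hm₁ hm₂ <;> try omega
  have := hm₁.eq_two_or_odd
  have := hm₂.eq_two_or_odd
  omega

theorem stmt_3 (n k' k'' : ℕ) (hn : 4 ≤ n) (hk' : 1 ≤ k') (hlt : k' < k'')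
    (h1 : Nat.primeCounting (n - k'') = k') (h2 : Nat.primeCounting (n - k') = k'') :
    k'' = k' + 1 ∧ Nat.Prime (n - k') ∧
      Nat.primeCounting (n - k') = k' + 1 ∧ Nat.primeCounting (n - k' - 1) = k' := by
  have ha : 2 ≤ n - k'' := by
    by_contra! h
    have := Nat.primeCounting_eq_zero_iff.mpr (Nat.le_of_lt_succ h)
    omega
  have hk : k'' = k' + 1 := by
    by_contra hne
    have htwo := Nat.primeCounting_add_two_le ha
    have hadd := Nat.primeCounting_add_le_add (n - k'' + 2) (k'' - k' - 2)
    rw [show n - k'' + 2 + (k'' - k' - 2) = n - k' by omega] at hadd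
    omega
  subst hk
  have hpred : n - k' - 1 = n - (k' + 1) := by omega
  have hsucc := Nat.primeCounting_succ_eq (n - (k' + 1))
  rw [show n - (k' + 1) + 1 = n - k' by omega] at hsucc
  refine ⟨rfl, ?_, h2, hpred ▸ h1⟩
  by_contra hp
  rw [if_neg hp] at hsucc
  omega
end

section
/- Fix integers a, b with 1 ≤ a ≤ b and let n be a positive integer such that the admissibility condition π(⌊(n − a·π(⌊n/b⌋))/b⌋) ≥ 1 holds. If there exists a positive integer s with n = a·s + b·p_s, then the iteration k_0 = π(⌊n/b⌋), k_{j+1} = π(⌊(n − a·k_j)/b⌋) is eventually constant and its eventual value equals s. -/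
/-- `p k` is the `k`-th prime number (`p 1 = 2`, `p 2 = 3`, ...). -/
noncomputable def p (k : ℕ) : ℕ := Nat.nth Nat.Prime (k - 1)

/-- The generalized iteration `k₀ = π(⌊n/b⌋)`, `k_{j+1} = π(⌊(n - a·k_j)/b⌋)`. -/
noncomputable def kseqG (a b n : ℕ) : ℕ → ℕ
  | 0 => Nat.primeCounting (n / b)
  | j + 1 => Nat.primeCounting ((n - a * kseqG a b n j) / b)

open Nat in
theorem primeCounting_succ_le (m : ℕ) : primeCounting (m + 1) ≤ primeCounting m + 1 := by
  unfold primeCounting primeCounting'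
  rw [count_succ _ (m + 1)]
  split_ifs <;> omega

open Nat in
theorem primeCounting_succ_of_not_prime {m : ℕ} (h : ¬ (m + 1).Prime) :
    primeCounting (m + 1) = primeCounting m := by
  simp [primeCounting, primeCounting', count_succ _ (m + 1), h]

theorem primeCounting_add_le (m c : ℕ) :
    Nat.primeCounting (m + c) ≤ Nat.primeCounting m + c := by
  induction c with
  | zero => simp
  | succ c ih =>
    have := primeCounting_succ_le (m + c)
    rw [← add_assoc]
    omega

theorem not_prime_of_even_of_two_lt {m : ℕ} (h : m % 2 = 0) (hm : 2 < m) : ¬ m.Prime := by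
  intro hp
  rcases hp.eq_two_or_odd with h' | h' <;> omega

/-- Above an odd number `q ≥ 3`, at most half of the first `e` integers are prime. -/
theorem primeCounting_add_le_half {q : ℕ} (hq : q % 2 = 1) (hq3 : 3 ≤ q) (e : ℕ) :
    Nat.primeCounting (q + e) ≤ Nat.primeCounting q + e / 2 := by
  induction e with
  | zero => simp
  | succ e ih =>
    rw [← add_assoc]
    rcases Nat.even_or_odd' e with ⟨t, rfl | rfl⟩
    · rw [primeCounting_succ_of_not_prime (not_prime_of_even_of_two_lt (by omega) (by omega))]
      omega
    · have := primeCounting_succ_le (q + (2 * t + 1))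
      omega

theorem prime_p (s : ℕ) : (p s).Prime := Nat.prime_nth_prime _

theorem primeCounting_p {s : ℕ} (hs : 0 < s) : Nat.primeCounting (p s) = s := by
  have h := prime_p s
  have h' : Nat.count Nat.Prime (p s) = s - 1 := Nat.primeCounting'_nth_eq (s - 1)
  simp only [Nat.primeCounting, Nat.primeCounting', Nat.count_succ, h, h', if_true]
  omega

theorem p_one : p 1 = 2 := by
  simp [p]

theorem stmt_15 (a b n : ℕ) (ha : 1 ≤ a) (hab : a ≤ b) (hn : 0 < n)
    (hadm : 1 ≤ Nat.primeCounting ((n - a * Nat.primeCounting (n / b)) / b))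
    (s : ℕ) (hs : 0 < s) (hsol : n = a * s + b * p s) :
    ∃ J : ℕ, ∀ j, J ≤ j → kseqG a b n j = s := by
  have hb : 0 < b := by omega
  have hπ := primeCounting_p hs
  have step_above : ∀ d, Nat.primeCounting ((n - a * (s + d)) / b) ≤ s ∧
      s ≤ Nat.primeCounting ((n - a * (s + d)) / b) + d := by
    intro d
    have e : n - a * (s + d) = b * p s - a * d := by rw [hsol, mul_add]; omega
    have had : a * d ≤ b * d := Nat.mul_le_mul_right d hab
    rw [e]
    constructor
    · conv_rhs => rw [← hπ]
      apply Nat.monotone_primeCounting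
      calc (b * p s - a * d) / b ≤ b * p s / b := Nat.div_le_div_right (by omega)
        _ = p s := Nat.mul_div_cancel_left _ hb
    · have h1 : p s - d ≤ (b * p s - a * d) / b := by
        rw [Nat.le_div_iff_mul_le hb, mul_comm, Nat.mul_sub]
        omega
      have h2 := Nat.monotone_primeCounting h1
      have h3 := primeCounting_add_le (p s - d) d
      have h4 := Nat.monotone_primeCounting (show p s ≤ p s - d + d by omega)
      omega
  have stable : ∀ j, kseqG a b n j = s → ∃ J : ℕ, ∀ j, J ≤ j → kseqG a b n j = s := by
    intro J hJ
    refine ⟨J, fun j hj => ?_⟩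
    induction j, hj using Nat.le_induction with
    | base => exact hJ
    | succ j _ ih =>
      have := step_above 0
      simp only [kseqG, ih]
      simp only [add_zero] at this
      omega
  rcases Nat.lt_or_ge 1 s with hs1 | hs1
  · have hp3 : 3 ≤ p s ∧ p s % 2 = 1 := by
      have h2 := (prime_p s).two_le
      have hne : p s ≠ 2 := by
        intro h
        rw [h] at hπ
        have : Nat.primeCounting 2 = 1 := by decide
        omega
      rcases (prime_p s).eq_two_or_odd with h | h <;> omega
    have step_below : ∀ k e, k + e = s → s ≤ Nat.primeCounting ((n - a * k) / b) ∧
        Nat.primeCounting ((n - a * k) / b) ≤ s + e / 2 := by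
      intro k e hke
      have h : n - a * k = a * e + b * p s := by rw [hsol, ← hke, mul_add]; omega
      have hae : a * e ≤ b * e := Nat.mul_le_mul_right e hab
      rw [h, Nat.add_mul_div_left _ _ hb]
      have h1 : a * e / b ≤ e := Nat.div_le_of_le_mul hae
      have h2 := primeCounting_add_le_half hp3.2 hp3.1 e
      have h3 := Nat.monotone_primeCounting (show a * e / b + p s ≤ p s + e by omega)
      have h4 := Nat.monotone_primeCounting (Nat.le_add_left (p s) (a * e / b))
      omega
    have descend : ∀ d j, kseqG a b n j = s + d →
        ∃ J : ℕ, ∀ j, J ≤ j → kseqG a b n j = s := by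
      intro d
      induction d using Nat.strong_induction_on with
      | _ d ih =>
        intro j hj
        rcases Nat.eq_zero_or_pos d with rfl | hd
        · exact stable j hj
        · have h1 := step_above d
          rw [← hj] at h1
          change kseqG a b n (j + 1) ≤ s ∧ s ≤ kseqG a b n (j + 1) + d at h1
          have h2 := step_below (kseqG a b n (j + 1)) (s - kseqG a b n (j + 1)) (by omega)
          change s ≤ kseqG a b n (j + 2) ∧ kseqG a b n (j + 2) ≤ _ at h2
          exact ih (kseqG a b n (j + 2) - s) (by omega) (j + 2) (by omega)
    have h0 := (step_below 0 s (by omega)).1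
    rw [mul_zero, Nat.sub_zero] at h0
    exact descend (kseqG a b n 0 - s) 0 (by simp only [kseqG]; omega)
  · obtain rfl : s = 1 := by omega
    rw [p_one, mul_one] at hsol
    have hdiv : n / b = a / b + 2 := by rw [hsol, Nat.add_mul_div_left _ _ hb]
    rcases hab.lt_or_eq with h | rfl
    · apply stable 0
      rw [kseqG, hdiv, Nat.div_eq_of_lt h]
      decide
    · exfalso
      have hπ3 : Nat.primeCounting 3 = 2 := by decide
      rw [hdiv, Nat.div_self hb, hπ3, show n - a * 2 = a by omega, Nat.div_self hb] at hadm
      exact absurd hadm (by decide)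
end
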